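/- Let A be a bounded operator on the separable Hilbert space H. The symmetric cochain E_A(F,G) = ⟨D₁F, A D₂G⟩ + ⟨D₁G, A D₂F⟩ maps F_HS × F_HS to F_HS; i.e., E_A(F,G) is of Hilbert-Schmidt type whenever F and G are. -/

import Mathlib

noncomputable section

variable {𝕜 : Type*} [RCLike 𝕜]
variable {H : Type*} [NormedAddCommGroup H] [InnerProductSpace 𝕜 H]

/-- Basis directions in `W = H ⊕ H*`: `(e_i, 0)` for `α = true` ("index `i`") and
`(0, e_i*)` for `α = false` ("index `i*`"), where `e_i* = ⟨e_i, ·⟩`. -/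
def dirVec (b : HilbertBasis ℕ 𝕜 H) (α : Bool) (i : ℕ) : H × (H →L[𝕜] 𝕜) :=
  if α then ((b i : H), 0) else (0, innerSL 𝕜 (b i))

/-- A function `F : W → 𝕜` on `W = H ⊕ H*` is of Hilbert-Schmidt type if it is Fréchet-smooth
and, for every `r ≥ 1`, every choice of directions (in `H` or `H*`) and every point `w`, the
family of `r`-th partial derivatives along basis directions is square-summable. -/
def IsHS (b : HilbertBasis ℕ 𝕜 H) (F : H × (H →L[𝕜] 𝕜) → 𝕜) : Prop :=
  ContDiff 𝕜 (⊤ : ℕ∞) F ∧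
  ∀ r : ℕ, 0 < r → ∀ (α : Fin r → Bool) (w : H × (H →L[𝕜] 𝕜)),
    Summable fun I : Fin r → ℕ =>
      ‖iteratedFDeriv 𝕜 r F w (fun k => dirVec b (α k) (I k))‖ ^ 2

/-- First partial Fréchet derivative `D₁F(x,η) ∈ H*` on `W = H ⊕ H*`. -/
def D1 (F : H × (H →L[𝕜] 𝕜) → 𝕜) (w : H × (H →L[𝕜] 𝕜)) : H →L[𝕜] 𝕜 :=
  (fderiv 𝕜 F w).comp (ContinuousLinearMap.inl 𝕜 H (H →L[𝕜] 𝕜))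

/-- Second partial Fréchet derivative `D₂F(x,η) ∈ H** ≅ H` on `W = H ⊕ H*`. -/
def D2 (F : H × (H →L[𝕜] 𝕜) → 𝕜) (w : H × (H →L[𝕜] 𝕜)) : (H →L[𝕜] 𝕜) →L[𝕜] 𝕜 :=
  (fderiv 𝕜 F w).comp (ContinuousLinearMap.inr 𝕜 H (H →L[𝕜] 𝕜))

/-- The symmetric cochain `E_A(F,G) = ⟨D₁F, A D₂G⟩ + ⟨D₁G, A D₂F⟩`; under `H** ≅ H` the
pairing `⟨ξ, A y⟩` is the evaluation of `y ∈ H**` on `ξ ∘ A ∈ H*`. -/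
def EA (A : H →L[𝕜] H) (F G : H × (H →L[𝕜] 𝕜) → 𝕜) (w : H × (H →L[𝕜] 𝕜)) : 𝕜 :=
  D2 G w ((D1 F w).comp A) + D2 F w ((D1 G w).comp A)

/-- Cauchy–Schwarz for a functional evaluated on an infinite linear combination. -/
theorem cs_aux {V : Type*} [NormedAddCommGroup V] [NormedSpace 𝕜 V] (Φ : V →L[𝕜] 𝕜)
    (c : ℕ → 𝕜) (e : ℕ → V) (v : V) (N : ℝ) (h1 : HasSum (fun k => c k • e k) v)
    (h2 : HasSum (fun k => ‖c k‖ ^ 2) N) (h3 : Summable fun k => ‖Φ (e k)‖ ^ 2) :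
    ‖Φ v‖ ^ 2 ≤ N * ∑' k, ‖Φ (e k)‖ ^ 2 := by
  have h4 : HasSum (fun k => Φ (c k • e k)) (Φ v) := h1.mapL Φ
  have h5 : Filter.Tendsto (fun s : Finset ℕ => ‖∑ k ∈ s, Φ (c k • e k)‖ ^ 2) Filter.atTop
      (nhds (‖Φ v‖ ^ 2)) := (Filter.Tendsto.norm h4).pow 2
  refine le_of_tendsto h5 (Filter.Eventually.of_forall fun s => ?_)
  have a1 : ‖∑ k ∈ s, Φ (c k • e k)‖ ≤ ∑ k ∈ s, ‖c k‖ * ‖Φ (e k)‖ := by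
    refine (norm_sum_le _ _).trans (le_of_eq ?_)
    refine Finset.sum_congr rfl fun k _ => ?_
    rw [map_smul, norm_smul]
  have a2 : ∑ k ∈ s, ‖c k‖ ^ 2 ≤ N := sum_le_hasSum s (fun _ _ => by positivity) h2
  have a3 : ∑ k ∈ s, ‖Φ (e k)‖ ^ 2 ≤ ∑' k, ‖Φ (e k)‖ ^ 2 :=
    h3.sum_le_tsum s (fun _ _ => by positivity)
  calc ‖∑ k ∈ s, Φ (c k • e k)‖ ^ 2 ≤ (∑ k ∈ s, ‖c k‖ * ‖Φ (e k)‖) ^ 2 := by gcongr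
    _ ≤ (∑ k ∈ s, ‖c k‖ ^ 2) * ∑ k ∈ s, ‖Φ (e k)‖ ^ 2 := Finset.sum_mul_sq_le_sq_mul_sq _ _ _
    _ ≤ N * ∑' k, ‖Φ (e k)‖ ^ 2 := by
        have : 0 ≤ ∑ k ∈ s, ‖c k‖ ^ 2 := by positivity
        exact mul_le_mul a2 a3 (by positivity) (this.trans a2)

theorem repr_sq (b : HilbertBasis ℕ 𝕜 H) (x : H) :
    HasSum (fun k => ‖b.repr x k‖ ^ 2) (‖x‖ ^ 2) := by
  have h := lp.hasSum_norm (p := 2) (by norm_num) (b.repr x)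
  simpa using h

theorem fst_bound (b : HilbertBasis ℕ 𝕜 H) (φ : H × (H →L[𝕜] 𝕜) →L[𝕜] 𝕜)
    (h : Summable fun k => ‖φ (dirVec b true k)‖ ^ 2) :
    ‖φ.comp (ContinuousLinearMap.inl 𝕜 H (H →L[𝕜] 𝕜))‖ ^ 2
      ≤ ∑' k, ‖φ (dirVec b true k)‖ ^ 2 := by
  have hS : 0 ≤ ∑' k, ‖φ (dirVec b true k)‖ ^ 2 := tsum_nonneg fun _ => by positivity
  refine (Real.le_sqrt (norm_nonneg _) hS).1 ?_
  refine ContinuousLinearMap.opNorm_le_bound _ (Real.sqrt_nonneg _) fun x => ?_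
  have := cs_aux (φ.comp (ContinuousLinearMap.inl 𝕜 H (H →L[𝕜] 𝕜))) _ _ x _ (b.hasSum_repr x)
    (repr_sq b x) (by simpa [dirVec] using h)
  refine (sq_le_sq₀ (norm_nonneg _) (by positivity)).1 ?_
  rw [mul_pow, Real.sq_sqrt hS, mul_comm]
  simpa [dirVec] using this

theorem snd_bound (b : HilbertBasis ℕ 𝕜 H) (φ : H × (H →L[𝕜] 𝕜) →L[𝕜] 𝕜)
    (h : Summable fun k => ‖φ (dirVec b false k)‖ ^ 2) (η : H →L[𝕜] 𝕜) :
    ‖φ (0, η)‖ ^ 2 ≤ ‖η‖ ^ 2 * ∑' k, ‖φ (dirVec b false k)‖ ^ 2 := by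
  have : CompleteSpace H :=
    (completeSpace_congr (e := b.repr.toEquiv) b.repr.isometry.isUniformEmbedding).2 inferInstance
  obtain ⟨y, rfl⟩ := (InnerProductSpace.toDual 𝕜 H).surjective η
  have h1 : HasSum (fun k => (starRingEnd 𝕜 (b.repr y k)) • innerSL 𝕜 (b k)) (innerSL 𝕜 y) := by
    have := (b.hasSum_repr y).mapL (innerSL 𝕜 (E := H))
    simpa only [map_smulₛₗ] using this
  have := cs_aux (φ.comp (ContinuousLinearMap.inr 𝕜 H (H →L[𝕜] 𝕜))) _ _ _ _ h1
    (by simpa using repr_sq b y) (by simpa [dirVec] using h)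
  rw [LinearIsometryEquiv.norm_map]
  have e : (InnerProductSpace.toDual 𝕜 H) y = innerSL 𝕜 y := rfl
  rw [e]
  simpa [dirVec] using this

/-- The map `φ ↦ (0, (φ ∘ inl) ∘ A)`. -/
def PhiA (A : H →L[𝕜] H) : (H × (H →L[𝕜] 𝕜) →L[𝕜] 𝕜) →L[𝕜] H × (H →L[𝕜] 𝕜) :=
  (ContinuousLinearMap.inr 𝕜 H (H →L[𝕜] 𝕜)).comp
    (((ContinuousLinearMap.compL 𝕜 H H 𝕜).flip A).comp
      ((ContinuousLinearMap.compL 𝕜 H (H × (H →L[𝕜] 𝕜)) 𝕜).flip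
        (ContinuousLinearMap.inl 𝕜 H (H →L[𝕜] 𝕜))))

theorem PhiA_apply (A : H →L[𝕜] H) (φ : H × (H →L[𝕜] 𝕜) →L[𝕜] 𝕜) :
    PhiA A φ = (0, (φ.comp (ContinuousLinearMap.inl 𝕜 H (H →L[𝕜] 𝕜))).comp A) := rfl

/-- Pointwise bound on the pairing. -/
theorem pair_bound (b : HilbertBasis ℕ 𝕜 H) (A : H →L[𝕜] H)
    (φ ψ : H × (H →L[𝕜] 𝕜) →L[𝕜] 𝕜)
    (h : Summable fun k => ‖φ (dirVec b true k)‖ ^ 2)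
    (h' : Summable fun k => ‖ψ (dirVec b false k)‖ ^ 2) :
    ‖ψ (PhiA A φ)‖ ^ 2 ≤ ‖A‖ ^ 2 *
      ((∑' k, ‖φ (dirVec b true k)‖ ^ 2) * ∑' k, ‖ψ (dirVec b false k)‖ ^ 2) := by
  rw [PhiA_apply]
  refine (snd_bound b ψ h' _).trans ?_
  rw [← mul_assoc]
  refine mul_le_mul_of_nonneg_right ?_ (tsum_nonneg fun _ => by positivity)
  calc _ ≤ (‖φ.comp (ContinuousLinearMap.inl 𝕜 H (H →L[𝕜] 𝕜))‖ * ‖A‖) ^ 2 := by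
        gcongr
        exact ContinuousLinearMap.opNorm_comp_le _ _
    _ = ‖A‖ ^ 2 * ‖φ.comp (ContinuousLinearMap.inl 𝕜 H (H →L[𝕜] 𝕜))‖ ^ 2 := by ring
    _ ≤ _ := by
        gcongr
        exact fst_bound b φ h

/-- Families of smooth `W*`-valued maps, Hilbert-Schmidt jointly in the family index. -/
def FamHS {ι : Type} (b : HilbertBasis ℕ 𝕜 H)
    (f : ι → H × (H →L[𝕜] 𝕜) → (H × (H →L[𝕜] 𝕜) →L[𝕜] 𝕜)) : Prop :=
  (∀ i, ContDiff 𝕜 (⊤ : ℕ∞) (f i)) ∧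
  ∀ (s : ℕ) (α : Fin s → Bool) (β : Bool) (w : H × (H →L[𝕜] 𝕜)),
    Summable fun p : ι × (Fin s → ℕ) × ℕ =>
      ‖iteratedFDeriv 𝕜 s (f p.1) w (fun k => dirVec b (α k) (p.2.1 k)) (dirVec b β p.2.2)‖ ^ 2

theorem contDiff_fderiv_top {V X : Type*} [NormedAddCommGroup V] [NormedSpace 𝕜 V]
    [NormedAddCommGroup X] [NormedSpace 𝕜 X] {f : V → X} (hf : ContDiff 𝕜 (⊤ : ℕ∞) f) :
    ContDiff 𝕜 (⊤ : ℕ∞) (fderiv 𝕜 f) :=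
  hf.fderiv_right (by simp)

theorem FamHS.of_isHS (b : HilbertBasis ℕ 𝕜 H) (F : H × (H →L[𝕜] 𝕜) → 𝕜) (hF : IsHS b F) :
    FamHS b (fun _ : Unit => fderiv 𝕜 F) := by
  refine ⟨fun _ => contDiff_fderiv_top hF.1, fun s α β w => ?_⟩
  have h := hF.2 (s + 1) (Nat.succ_pos s) (Fin.snoc (α := fun _ => Bool) α β) w
  have hinj : Function.Injective (fun p : Unit × (Fin s → ℕ) × ℕ =>
      (Fin.snoc (α := fun _ => ℕ) p.2.1 p.2.2 : Fin (s + 1) → ℕ)) := by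
    rintro ⟨_, I, k⟩ ⟨_, J, l⟩ hh
    have := Fin.snoc_inj.1 hh
    simp_all
  refine (h.comp_injective hinj).congr fun p => ?_
  simp only [Function.comp_def]
  rw [iteratedFDeriv_succ_apply_right]
  simp [Fin.init_def]

/-- Differentiating a Hilbert-Schmidt family along basis directions. -/
theorem FamHS.deriv {ι : Type} (b : HilbertBasis ℕ 𝕜 H)
    (f : ι → H × (H →L[𝕜] 𝕜) → (H × (H →L[𝕜] 𝕜) →L[𝕜] 𝕜)) (hf : FamHS b f) (γ : Bool) :
    FamHS b (fun (p : ι × ℕ) w => fderiv 𝕜 (f p.1) w (dirVec b γ p.2)) := by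
  refine ⟨fun p => (contDiff_fderiv_top (hf.1 p.1)).clm_apply contDiff_const, fun s α β w => ?_⟩
  have h := hf.2 (s + 1) (Fin.snoc (α := fun _ => Bool) α γ) β w
  have hinj : Function.Injective (fun p : (ι × ℕ) × (Fin s → ℕ) × ℕ =>
      ((p.1.1, (Fin.snoc (α := fun _ => ℕ) p.2.1 p.1.2 : Fin (s + 1) → ℕ), p.2.2) :
        ι × (Fin (s + 1) → ℕ) × ℕ)) := by
    rintro ⟨⟨i, m⟩, I, k⟩ ⟨⟨j, n⟩, J, l⟩ hh
    simp only [Prod.mk.injEq] at hh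
    have := Fin.snoc_inj.1 hh.2.1
    simp_all
  refine (h.comp_injective hinj).congr fun p => ?_
  simp only [Function.comp_def]
  rw [iteratedFDeriv_succ_apply_right, iteratedFDeriv_clm_apply_const_apply
    (contDiff_fderiv_top (hf.1 p.1.1)) (by exact_mod_cast le_top)]
  simp [Fin.init_def]

theorem contDiff_pair_gen {V : Type*} [NormedAddCommGroup V] [NormedSpace 𝕜 V]
    (P : (V →L[𝕜] 𝕜) →L[𝕜] V) {f g : V → (V →L[𝕜] 𝕜)}
    (hf : ContDiff 𝕜 (⊤ : ℕ∞) f) (hg : ContDiff 𝕜 (⊤ : ℕ∞) g) :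
    ContDiff 𝕜 (⊤ : ℕ∞) (fun w => g w (P (f w))) :=
  hg.clm_apply (P.contDiff.comp hf)

theorem fderiv_pair_gen {V : Type*} [NormedAddCommGroup V] [NormedSpace 𝕜 V]
    (P : (V →L[𝕜] 𝕜) →L[𝕜] V) {f g : V → (V →L[𝕜] 𝕜)}
    (hf : ContDiff 𝕜 (⊤ : ℕ∞) f) (hg : ContDiff 𝕜 (⊤ : ℕ∞) g) (w v : V) :
    fderiv 𝕜 (fun w => g w (P (f w))) w v =
      g w (P (fderiv 𝕜 f w v)) + fderiv 𝕜 g w v (P (f w)) := by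
  have h1 : HasFDerivAt f (fderiv 𝕜 f w) w := (hf.differentiable (by simp) w).hasFDerivAt
  have h2 : HasFDerivAt g (fderiv 𝕜 g w) w := (hg.differentiable (by simp) w).hasFDerivAt
  have h0 : HasFDerivAt (fun w => P (f w)) (P.comp (fderiv 𝕜 f w)) w :=
    P.hasFDerivAt.comp w h1
  rw [(h2.clm_apply h0).fderiv]
  simp

theorem contDiff_pair (A : H →L[𝕜] H)
    {f g : H × (H →L[𝕜] 𝕜) → (H × (H →L[𝕜] 𝕜) →L[𝕜] 𝕜)}
    (hf : ContDiff 𝕜 (⊤ : ℕ∞) f) (hg : ContDiff 𝕜 (⊤ : ℕ∞) g) :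
    ContDiff 𝕜 (⊤ : ℕ∞) (fun w => g w (PhiA A (f w))) :=
  contDiff_pair_gen (V := H × (H →L[𝕜] 𝕜)) (PhiA A) hf hg

theorem fderiv_pair (A : H →L[𝕜] H)
    {f g : H × (H →L[𝕜] 𝕜) → (H × (H →L[𝕜] 𝕜) →L[𝕜] 𝕜)}
    (hf : ContDiff 𝕜 (⊤ : ℕ∞) f) (hg : ContDiff 𝕜 (⊤ : ℕ∞) g) (w v : H × (H →L[𝕜] 𝕜)) :
    fderiv 𝕜 (fun w => g w (PhiA A (f w))) w v =
      g w (PhiA A (fderiv 𝕜 f w v)) + fderiv 𝕜 g w v (PhiA A (f w)) :=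
  fderiv_pair_gen (V := H × (H →L[𝕜] 𝕜)) (PhiA A) hf hg w v

theorem summable_sq_add {ι : Type*} {u v : ι → 𝕜} (hu : Summable fun i => ‖u i‖ ^ 2)
    (hv : Summable fun i => ‖v i‖ ^ 2) : Summable fun i => ‖u i + v i‖ ^ 2 := by
  refine Summable.of_nonneg_of_le (fun _ => by positivity) (fun i => ?_)
    ((hu.mul_left 2).add (hv.mul_left 2))
  have h1 := norm_add_le (u i) (v i)
  have h2 : ‖u i + v i‖ ^ 2 ≤ (‖u i‖ + ‖v i‖) ^ 2 := by gcongr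
  nlinarith [sq_nonneg (‖u i‖ - ‖v i‖)]

theorem FamHS.zero {ι : Type} (b : HilbertBasis ℕ 𝕜 H)
    (f : ι → H × (H →L[𝕜] 𝕜) → (H × (H →L[𝕜] 𝕜) →L[𝕜] 𝕜)) (hf : FamHS b f) (β : Bool)
    (w : H × (H →L[𝕜] 𝕜)) :
    Summable fun p : ι × ℕ => ‖f p.1 w (dirVec b β p.2)‖ ^ 2 := by
  have h := hf.2 0 (fun _ => true) β w
  have hinj : Function.Injective (fun p : ι × ℕ =>
      ((p.1, (fun _ => 0), p.2) : ι × (Fin 0 → ℕ) × ℕ)) := by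
    rintro ⟨i, m⟩ ⟨j, n⟩ hh
    simpa using hh
  refine (h.comp_injective hinj).congr fun p => ?_
  simp

/-- The main induction. -/
theorem pair_summable (b : HilbertBasis ℕ 𝕜 H) (A : H →L[𝕜] H) (r : ℕ) :
    ∀ {ι κ : Type} (f : ι → H × (H →L[𝕜] 𝕜) → (H × (H →L[𝕜] 𝕜) →L[𝕜] 𝕜))
      (g : κ → H × (H →L[𝕜] 𝕜) → (H × (H →L[𝕜] 𝕜) →L[𝕜] 𝕜)),
      FamHS b f → FamHS b g → ∀ (α : Fin r → Bool) (w : H × (H →L[𝕜] 𝕜)),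
      Summable fun p : (ι × κ) × (Fin r → ℕ) =>
        ‖iteratedFDeriv 𝕜 r (fun w => g p.1.2 w (PhiA A (f p.1.1 w))) w
          (fun k => dirVec b (α k) (p.2 k))‖ ^ 2 := by
  induction r with
  | zero =>
    intro ι κ f g hf hg α w
    obtain ⟨f1, f2⟩ := (summable_prod_of_nonneg (fun _ => by positivity)).1 (hf.zero b f true w)
    obtain ⟨g1, g2⟩ := (summable_prod_of_nonneg (fun _ => by positivity)).1 (hg.zero b g false w)
    have hfg := (f2.mul_of_nonneg g2 (fun _ => tsum_nonneg fun _ => by positivity)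
      (fun _ => tsum_nonneg fun _ => by positivity)).mul_left (‖A‖ ^ 2)
    have hfg' := hfg.comp_injective (Equiv.prodUnique (ι × κ) (Fin 0 → ℕ)).injective
    refine Summable.of_nonneg_of_le (fun _ => by positivity) (fun p => ?_) hfg'
    simp only [iteratedFDeriv_zero_apply]
    exact pair_bound b A _ _ (f1 p.1.1) (g1 p.1.2)
  | succ r ih =>
    intro ι κ f g hf hg α w
    have s1 := ih _ g (hf.deriv b f (α (Fin.last r))) hg (Fin.init α) w
    have s2 := ih f _ hf (hg.deriv b g (α (Fin.last r))) (Fin.init α) w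
    have i1 : Function.Injective (fun q : (ι × κ) × (Fin (r + 1) → ℕ) =>
        ((((q.1.1, q.2 (Fin.last r)), q.1.2), fun k => q.2 k.castSucc) :
          ((ι × ℕ) × κ) × (Fin r → ℕ))) := by
      rintro ⟨⟨i, j⟩, I⟩ ⟨⟨i', j'⟩, I'⟩ hh
      simp only [Prod.mk.injEq] at hh
      obtain ⟨⟨⟨h1, h2⟩, h3⟩, h4⟩ := hh
      have : I = I' := by
        funext k
        refine Fin.lastCases h2 (fun k => congrFun h4 k) k
      simp_all
    have i2 : Function.Injective (fun q : (ι × κ) × (Fin (r + 1) → ℕ) =>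
        (((q.1.1, (q.1.2, q.2 (Fin.last r))), fun k => q.2 k.castSucc) :
          (ι × (κ × ℕ)) × (Fin r → ℕ))) := by
      rintro ⟨⟨i, j⟩, I⟩ ⟨⟨i', j'⟩, I'⟩ hh
      simp only [Prod.mk.injEq] at hh
      obtain ⟨⟨h1, h3, h2⟩, h4⟩ := hh
      have : I = I' := by
        funext k
        refine Fin.lastCases h2 (fun k => congrFun h4 k) k
      simp_all
    refine (summable_sq_add (s1.comp_injective i1) (s2.comp_injective i2)).congr fun p => ?_
    have hfc := hf.1 p.1.1
    have hgc := hg.1 p.1.2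
    have hP := contDiff_pair A hfc hgc
    congr 2
    rw [iteratedFDeriv_succ_apply_right, ← iteratedFDeriv_clm_apply_const_apply
      (contDiff_fderiv_top hP) (by exact_mod_cast le_top)]
    simp only [fderiv_pair A hfc hgc]
    rw [fun_iteratedFDeriv_add_apply]
    · rfl
    · exact ((contDiff_pair A ((contDiff_fderiv_top hfc).clm_apply contDiff_const) hgc).of_le
        (by exact_mod_cast le_top)).contDiffAt
    · exact ((contDiff_pair A hfc ((contDiff_fderiv_top hgc).clm_apply contDiff_const)).of_le
        (by exact_mod_cast le_top)).contDiffAt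

theorem pair_summable_single (b : HilbertBasis ℕ 𝕜 H) (A : H →L[𝕜] H)
    (F G : H × (H →L[𝕜] 𝕜) → 𝕜) (hF : IsHS b F) (hG : IsHS b G) (r : ℕ)
    (α : Fin r → Bool) (w : H × (H →L[𝕜] 𝕜)) :
    Summable fun I : Fin r → ℕ =>
      ‖iteratedFDeriv 𝕜 r (fun w => fderiv 𝕜 G w (PhiA A (fderiv 𝕜 F w))) w
          (fun k => dirVec b (α k) (I k))‖ ^ 2 := by
  have h := pair_summable b A r _ _ (FamHS.of_isHS b F hF) (FamHS.of_isHS b G hG) α w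
  exact h.comp_injective (i := fun I : Fin r → ℕ => (((), ()), I)) fun I J hh => by simpa using hh

/-- for any bounded operator `A` on `H`, the cochain `E_A` maps
`F_HS × F_HS` to `F_HS`. -/
theorem EA_isHS (b : HilbertBasis ℕ 𝕜 H) (A : H →L[𝕜] H)
    (F G : H × (H →L[𝕜] 𝕜) → 𝕜) (hF : IsHS b F) (hG : IsHS b G) :
    IsHS b (EA A F G) := by
  have e : EA A F G = fun w => fderiv 𝕜 G w (PhiA A (fderiv 𝕜 F w)) +
      fderiv 𝕜 F w (PhiA A (fderiv 𝕜 G w)) := rfl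
  have c1 := contDiff_pair A (contDiff_fderiv_top hF.1) (contDiff_fderiv_top hG.1)
  have c2 := contDiff_pair A (contDiff_fderiv_top hG.1) (contDiff_fderiv_top hF.1)
  rw [e]
  refine ⟨c1.add c2, fun r _ α w => ?_⟩
  refine (summable_sq_add (pair_summable_single b A F G hF hG r α w)
    (pair_summable_single b A G F hG hF r α w)).congr fun I => ?_
  rw [fun_iteratedFDeriv_add_apply (c1.of_le (by exact_mod_cast le_top)).contDiffAt
    (c2.of_le (by exact_mod_cast le_top)).contDiffAt]
  rfl

end
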